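/- Let l, m, n be nonnegative integers with gcd(l,m) = gcd(l,n) = 1. Then for any basepoint, the second homotopy group π₂(𝔑^l_{m,n}) of the orbit space 𝔑^l_{m,n} is an infinite cyclic group, i.e., it is isomorphic (as a group) to ℤ. -/

import Mathlib

noncomputable section

open Quaternion

/-- The embedding of `ℂ` into the quaternions, sending `a + b·i` to the quaternion `a + b·i`. -/
def cq (x : ℂ) : Quaternion ℝ := ⟨x.re, x.im, 0, 0⟩

/-- The total space `𝕊³_ℍ × 𝕊³`: pairs of a unit quaternion and a point `(z,w) ∈ ℂ²`
with `|z|² + |w|² = 1`. -/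
abbrev TotalSpace : Type :=
  {a : Quaternion ℝ × (ℂ × ℂ) // ‖a.1‖ = 1 ∧ Complex.normSq a.2.1 + Complex.normSq a.2.2 = 1}

/-- The circle action `x · (p,(z,w)) = (p x^l, (x^m z, x^n w))` on the ambient space. -/
def circleAct (l m n : ℕ) (x : Circle) (a : Quaternion ℝ × (ℂ × ℂ)) :
    Quaternion ℝ × (ℂ × ℂ) :=
  (a.1 * cq ((x : ℂ) ^ l), ((x : ℂ) ^ m * a.2.1, (x : ℂ) ^ n * a.2.2))

/-- The orbit relation of the circle action on `𝕊³_ℍ × 𝕊³`. -/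
def NRel (l m n : ℕ) (a b : TotalSpace) : Prop :=
  ∃ x : Circle, circleAct l m n x a.1 = b.1

/-- The orbit space `𝔑^l_{m,n}`, with the quotient topology. -/
abbrev NSpace (l m n : ℕ) : Type := Quot (NRel l m n)


open scoped Topology

open scoped unitInterval

theorem ContinuousMap.HomotopicRel.mono {X Y : Type*} [TopologicalSpace X] [TopologicalSpace Y]
    {f g : C(X, Y)} {S T : Set X} (h : f.HomotopicRel g T) (hST : S ⊆ T) :
    f.HomotopicRel g S :=
  h.map fun H ↦ ⟨H.toHomotopy, fun t x hx ↦ H.prop' t x (hST hx)⟩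

section Sphere

open Metric

variable {V : Type*} [NormedAddCommGroup V] [InnerProductSpace ℝ V]

/-- A map to the unit sphere is homotopic to the normalization of any nearby map to the ambient
space, relative to the coincidence set. -/
theorem homotopicRel_of_norm_sub_lt_one {X : Type*} [TopologicalSpace X]
    (f : C(X, sphere (0 : V) 1)) (F : C(X, V)) (hF : ∀ x, ‖F x - f x‖ < 1) :
    ∃ g : C(X, sphere (0 : V) 1), (∀ x, (g x : V) = ‖F x‖⁻¹ • F x) ∧
      f.HomotopicRel g {x | F x = f x} := by
  have hne (t : I) (x : X) : (f x : V) + (t : ℝ) • (F x - f x) ≠ 0 := by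
    intro h
    have h1 : ‖(f x : V)‖ = 1 := by simp
    rw [eq_neg_of_add_eq_zero_left h, norm_neg, norm_smul, Real.norm_of_nonneg t.2.1] at h1
    nlinarith [hF x, t.2.1, t.2.2, norm_nonneg (F x - f x)]
  have hmem {v : V} (hv : v ≠ 0) : ‖v‖⁻¹ • v ∈ sphere (0 : V) 1 := by
    simp [norm_smul, hv]
  have hc : Continuous fun p : I × X ↦ (f p.2 : V) + (p.1 : ℝ) • (F p.2 - f p.2) := by fun_prop
  have hF0 (x : X) : F x ≠ 0 := by simpa using hne 1 x
  refine ⟨⟨fun x ↦ ⟨‖F x‖⁻¹ • F x, hmem (hF0 x)⟩, ?_⟩, fun x ↦ rfl, ⟨⟨⟨⟨fun p ↦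
    ⟨‖(f p.2 : V) + (p.1 : ℝ) • (F p.2 - f p.2)‖⁻¹ • ((f p.2 : V) + (p.1 : ℝ) • (F p.2 - f p.2)),
      hmem (hne _ _)⟩, ?_⟩, ?_, ?_⟩, ?_⟩⟩⟩
  · exact ((F.continuous.norm.inv₀ fun x ↦ norm_ne_zero_iff.2 (hF0 x)).smul
      F.continuous).subtype_mk _
  · exact ((hc.norm.inv₀ fun p ↦ norm_ne_zero_iff.2 (hne _ _)).smul hc).subtype_mk _
  · intro x
    ext1
    simp
  · intro x
    ext1
    simp
  · intro t x hx
    ext1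
    simp [show F x = f x from hx]

/-- A map to the unit sphere that misses a point `v` contracts to any point `e ≠ v`, relative to
the fibre over `e`. -/
theorem homotopicRel_const_of_ne {X : Type*} [TopologicalSpace X]
    (f : C(X, sphere (0 : V) 1)) (e v : sphere (0 : V) 1) (hev : e ≠ v) (hf : ∀ x, f x ≠ v) :
    f.HomotopicRel (ContinuousMap.const X e) {x | f x = e} := by
  have hv : ‖(v : V)‖ = 1 := by simp
  have hsrc {u : sphere (0 : V) 1} (hu : u ≠ v) : u ∈ (stereographic hv).source := by
    simpa using hu
  have hcont : Continuous fun x ↦ stereographic hv (f x) :=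
    (stereographic hv).continuousOn.comp_continuous f.continuous fun x ↦ hsrc (hf x)
  have hsymm : Continuous (stereographic hv).symm :=
    continuousOn_univ.1 (by simpa using (stereographic hv).continuousOn_symm)
  refine ⟨⟨⟨⟨fun p ↦ (stereographic hv).symm (AffineMap.lineMap (stereographic hv (f p.2))
    (stereographic hv e) (p.1 : ℝ)), ?_⟩, ?_, ?_⟩, ?_⟩⟩
  · refine hsymm.comp ?_
    simp only [AffineMap.lineMap_apply_module]
    have ht : Continuous fun p : I × X ↦ (p.1 : ℝ) := by fun_prop
    exact ((continuous_const.sub ht).smul (hcont.comp continuous_snd)).add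
      (ht.smul continuous_const)
  · intro x
    simp only [Set.Icc.coe_zero, AffineMap.lineMap_apply_zero]
    exact (stereographic hv).left_inv (hsrc (hf x))
  · intro x
    simp only [Set.Icc.coe_one, AffineMap.lineMap_apply_one]
    exact (stereographic hv).left_inv (hsrc hev)
  · intro t x hx
    have hx' : f x = e := hx
    simp only [hx', AffineMap.lineMap_same_apply, ContinuousMap.coe_mk]
    exact (stereographic hv).left_inv (hsrc hev)

/-- Maps from a cube to a sphere of larger dimension contract to any point `e`,
relative to the fibre over `e`. -/
theorem homotopicRel_const_of_lt_finrank [FiniteDimensional ℝ V] {k : ℕ}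
    (hk : k + 1 < Module.finrank ℝ V) (f : C(Fin k → I, sphere (0 : V) 1))
    (e : sphere (0 : V) 1) :
    f.HomotopicRel (ContinuousMap.const _ e) {x | f x = e} := by
  let proj : (Fin k → ℝ) → (Fin k → I) := fun y i ↦ Set.projIcc 0 1 zero_le_one (y i)
  have hproj : Continuous proj := by fun_prop
  obtain ⟨g, hg, hgd, hgs⟩ := Continuous.exists_contDiff_approx (n := 1)
    (f := fun y ↦ (f (proj y) : V) - e) (ε := fun _ ↦ 1) (by fun_prop) continuous_const
    fun _ ↦ one_pos
  have hdense : Dense (Set.range fun q : (Fin k → ℝ) × ℝ ↦ q.2 • ((e : V) + g q.1))ᶜ := by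
    refine ContDiff.dense_compl_range_of_finrank_lt_finrank ?_ (by simpa using hk)
    exact contDiff_snd.smul (contDiff_const.add (hg.comp contDiff_fst))
  obtain ⟨v, hvr, hv⟩ := hdense.exists_dist_lt (-(e : V)) one_pos
  have hv0 : v ≠ 0 := by
    rintro rfl
    exact hvr ⟨(0, 0), by simp⟩
  let incl : (Fin k → I) → (Fin k → ℝ) := fun y i ↦ y i
  have hincl : Continuous incl := by fun_prop
  have hpi (x : Fin k → I) : proj (incl x) = x := by
    funext i
    exact Set.projIcc_val zero_le_one (x i)
  let F : C(Fin k → I, V) := ⟨fun x ↦ e + g (incl x),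
    continuous_const.add (hg.continuous.comp hincl)⟩
  obtain ⟨f', hf', hh⟩ := homotopicRel_of_norm_sub_lt_one f F fun x ↦ by
    have := hgd (incl x)
    rw [hpi, dist_eq_norm] at this
    rwa [show g (incl x) - ((f x : V) - e) = F x - f x from by
      change _ = (e : V) + g (incl x) - f x
      abel] at this
  have hgz (x : Fin k → I) (hx : f x = e) : F x = e := by
    have : g (incl x) = 0 := by
      by_contra h
      exact hgs h (by simp [hpi, hx])
    simp [F, this]
  have hfe : {x | f x = e} ⊆ {x | f' x = e} := fun x hx ↦ by
    ext1
    simp [hf', hgz x hx]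
  let v' : sphere (0 : V) 1 := ⟨‖v‖⁻¹ • v, by simp [norm_smul, hv0]⟩
  have hnv : ‖v‖ ≠ 0 := norm_ne_zero_iff.2 hv0
  have hv' : v = ‖v‖ • (v' : V) := by simp [v', smul_smul, hnv]
  refine ContinuousMap.HomotopicRel.trans (ContinuousMap.HomotopicRel.mono hh ?_)
    (ContinuousMap.HomotopicRel.mono (homotopicRel_const_of_ne f' e v' ?_ ?_) hfe)
  · intro x hx
    simp [hgz x hx, show f x = e from hx]
  · intro h
    rw [hv', ← h, dist_eq_norm, ← norm_neg, show -(-(e : V) - ‖v‖ • (e : V)) = (1 + ‖v‖) • (e : V)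
      by module, norm_smul, norm_eq_of_mem_sphere, Real.norm_of_nonneg (by positivity)] at hv
    linarith [norm_nonneg v]
  · intro x hx
    refine hvr ⟨(incl x, ‖v‖ * ‖F x‖⁻¹), ?_⟩
    have hvx : v = (‖v‖ * ‖F x‖⁻¹) • F x := by rwa [← hx, hf', smul_smul] at hv'
    exact hvx.symm

end Sphere

section Phase

/-- The phase `z / |z|` of a complex number, with value `1` at `0`. -/
def phase (z : ℂ) : Circle := Circle.exp z.arg

theorem coe_phase {z : ℂ} (hz : z ≠ 0) : (phase z : ℂ) = z / ‖z‖ := by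
  rw [phase, Circle.coe_exp, eq_div_iff (by simpa using hz), mul_comm,
    Complex.norm_mul_exp_arg_mul_I]

theorem phase_mul (x : Circle) {z : ℂ} (hz : z ≠ 0) : phase (x * z) = x * phase z := by
  ext
  rw [Circle.coe_mul, coe_phase hz, coe_phase (by simpa using hz)]
  rw [norm_mul, Circle.norm_coe, one_mul, mul_div_assoc]

theorem phase_ofReal {r : ℝ} (hr : 0 < r) : phase r = 1 := by
  rw [phase, Complex.arg_ofReal_of_nonneg hr.le, Circle.exp_zero]

theorem continuousAt_phase {z : ℂ} (hz : z ≠ 0) : ContinuousAt phase z := by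
  have hi : Topology.IsInducing ((↑) : Circle → ℂ) := ⟨rfl⟩
  refine hi.continuousAt_iff.2 ?_
  have h : ContinuousAt (fun w : ℂ ↦ w / ‖w‖) z :=
    continuousAt_id.div (by fun_prop) (by simpa using hz)
  refine h.congr ?_
  filter_upwards [isOpen_ne.mem_nhds hz] with w hw
  exact (coe_phase hw).symm

end Phase

/-- `π : E → B` is the orbit map of a circle action on `E`, and `ψ` is an equivariant comparison
function on pairs of points of `E` that is positive on the diagonal. The phase of `ψ e e'` then
measures the relative position of nearby points, so `π` is a principal circle bundle. -/
structure IsCircleBundle {E B : Type*} [TopologicalSpace E] [TopologicalSpace B]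
    [MulAction Circle E] (π : E → B) (ψ : E → E → ℂ) : Prop where
  isOpenQuotientMap : IsOpenQuotientMap π
  eq_iff : ∀ e e', π e = π e' ↔ ∃ x : Circle, x • e = e'
  continuous_comparison : Continuous fun p : E × E ↦ ψ p.1 p.2
  comparison_smul_right : ∀ (x : Circle) (e e' : E), ψ e (x • e') = x * ψ e e'
  comparison_smul_left : ∀ (x : Circle) (e e' : E), ψ (x • e) e' = (x⁻¹ : Circle) * ψ e e'
  comparison_self : ∀ e, ∃ r : ℝ, 0 < r ∧ ψ e e = r

namespace IsCircleBundle

open scoped Topology.Homotopy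

variable {E B : Type*} [TopologicalSpace E] [TopologicalSpace B] [MulAction Circle E]
  {π : E → B} {ψ : E → E → ℂ}

theorem proj_smul (h : IsCircleBundle π ψ) (x : Circle) (e : E) : π (x • e) = π e :=
  ((h.eq_iff _ _).2 ⟨x, rfl⟩).symm

theorem comparison_self_ne_zero (h : IsCircleBundle π ψ) (e : E) : ψ e e ≠ 0 := by
  obtain ⟨r, hr, he⟩ := h.comparison_self e
  simpa [he] using hr.ne'

theorem comparison_ne_zero (h : IsCircleBundle π ψ) {e e' : E} (he : π e = π e') :
    ψ e e' ≠ 0 := by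
  obtain ⟨x, rfl⟩ := (h.eq_iff _ _).1 he
  simpa [h.comparison_smul_right] using h.comparison_self_ne_zero e

theorem phase_smul (h : IsCircleBundle π ψ) (x : Circle) (e : E) : phase (ψ e (x • e)) = x := by
  obtain ⟨r, hr, he⟩ := h.comparison_self e
  rw [h.comparison_smul_right, phase_mul _ (h.comparison_self_ne_zero e), he, phase_ofReal hr,
    mul_one]

theorem phase_smul_self (h : IsCircleBundle π ψ) {e e' : E} (he : π e = π e') :
    phase (ψ e e') • e = e' := by
  obtain ⟨x, rfl⟩ := (h.eq_iff _ _).1 he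
  rw [h.phase_smul]

/-- The point over `b` in phase with `e`. -/
def transport (h : IsCircleBundle π ψ) (e : E) (b : B) : E :=
  (phase (ψ e (Function.surjInv h.isOpenQuotientMap.surjective b)))⁻¹ •
    Function.surjInv h.isOpenQuotientMap.surjective b

theorem proj_transport (h : IsCircleBundle π ψ) (e : E) (b : B) : π (h.transport e b) = b := by
  rw [transport, h.proj_smul, Function.surjInv_eq h.isOpenQuotientMap.surjective]

theorem transport_proj (h : IsCircleBundle π ψ) {e e' : E} (he : ψ e e' ≠ 0) :
    h.transport e (π e') = (phase (ψ e e'))⁻¹ • e' := by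
  obtain ⟨x, hx⟩ := (h.eq_iff _ _).1
    (Function.surjInv_eq h.isOpenQuotientMap.surjective (π e')).symm
  rw [transport, ← hx, h.comparison_smul_right, phase_mul _ he, mul_inv_rev, mul_smul,
    inv_smul_smul]

theorem transport_self (h : IsCircleBundle π ψ) (e : E) : h.transport e (π e) = e := by
  obtain ⟨r, hr, he⟩ := h.comparison_self e
  rw [h.transport_proj (h.comparison_self_ne_zero e), he, phase_ofReal hr, inv_one, one_smul]

/-- The pairs of points of the base whose fibres can be compared. -/
def near (π : E → B) (ψ : E → E → ℂ) : Set (B × B) :=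
  Prod.map π π '' {p : E × E | ψ p.1 p.2 ≠ 0}

theorem isOpen_near (h : IsCircleBundle π ψ) : IsOpen (near π ψ) :=
  (h.isOpenQuotientMap.prodMap h.isOpenQuotientMap).isOpenMap _
    (isOpen_ne.preimage h.continuous_comparison)

theorem mk_self_mem_near (h : IsCircleBundle π ψ) (b : B) : (b, b) ∈ near π ψ := by
  obtain ⟨e, rfl⟩ := h.isOpenQuotientMap.surjective b
  exact ⟨(e, e), h.comparison_self_ne_zero e, rfl⟩

theorem mem_near_iff (h : IsCircleBundle π ψ) {e e' : E} :
    (π e, π e') ∈ near π ψ ↔ ψ e e' ≠ 0 := by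
  refine ⟨?_, fun he ↦ ⟨(e, e'), he, rfl⟩⟩
  rintro ⟨⟨a, a'⟩, ha, haa⟩
  simp only [Prod.map_apply, Prod.mk.injEq] at haa
  obtain ⟨x, rfl⟩ := (h.eq_iff _ _).1 haa.1
  obtain ⟨y, rfl⟩ := (h.eq_iff _ _).1 haa.2
  simpa [h.comparison_smul_left, h.comparison_smul_right] using ha

theorem continuousAt_transport [ContinuousSMul Circle E] (h : IsCircleBundle π ψ) {e : E} {b : B}
    (hb : (π e, b) ∈ near π ψ) : ContinuousAt (fun p : E × B ↦ h.transport p.1 p.2) (e, b) := by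
  obtain ⟨e', rfl⟩ := h.isOpenQuotientMap.surjective b
  rw [h.mem_near_iff] at hb
  have hq : IsOpenQuotientMap (Prod.map id π : E × E → E × B) :=
    IsOpenQuotientMap.id.prodMap h.isOpenQuotientMap
  refine (hq.continuousAt_comp_iff (x := (e, e'))).1 ?_
  have hc : ContinuousAt (fun p : E × E ↦ (phase (ψ p.1 p.2))⁻¹ • p.2) (e, e') :=
    ((ContinuousAt.comp (f := fun p : E × E ↦ ψ p.1 p.2) (continuousAt_phase hb)
      h.continuous_comparison.continuousAt).inv).smul continuousAt_snd
  refine hc.congr ?_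
  filter_upwards [(isOpen_ne.preimage h.continuous_comparison).mem_nhds hb] with p hp
  exact (h.transport_proj hp).symm

theorem exists_near_of_dist_le (h : IsCircleBundle π ψ) {X : Type*} [TopologicalSpace X]
    [CompactSpace X] (H : C(X × I, B)) :
    ∃ N : ℕ, ∀ (x : X) (t t' : I), dist t t' ≤ 1 / (N + 1 : ℝ) →
      (H (x, t), H (x, t')) ∈ near π ψ := by
  let W : Set (I × I) := {q | ∀ x : X, (H (x, q.1), H (x, q.2)) ∈ near π ψ}
  have hW : IsOpen W := by
    have hc : IsClosed {p : X × (I × I) | (H (p.1, p.2.1), H (p.1, p.2.2)) ∉ near π ψ} :=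
      (h.isOpen_near.preimage (by fun_prop)).isClosed_compl
    have := (isClosedMap_snd_of_compactSpace _ hc).isOpen_compl
    convert this using 1
    ext q
    simp [W]
  have hWu : W ∈ uniformity I := by
    rw [← nhdsSet_diagonal_eq_uniformity, hW.mem_nhdsSet]
    rintro ⟨t, t'⟩ ht x
    obtain rfl : t = t' := ht
    exact h.mk_self_mem_near _
  obtain ⟨δ, hδ, hδW⟩ := Metric.mem_uniformity_dist.1 hWu
  obtain ⟨N, hN⟩ := exists_nat_one_div_lt hδ
  exact ⟨N, fun x t t' htt ↦ hδW (htt.trans_lt hN) x⟩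

/-- The homotopy lifting property; the lift is stationary wherever the homotopy is. -/
theorem exists_homotopy_lift [ContinuousSMul Circle E] (h : IsCircleBundle π ψ) {X : Type*}
    [TopologicalSpace X] [CompactSpace X] (H : C(X × I, B)) (f : C(X, E))
    (hf : ∀ x, π (f x) = H (x, 0)) :
    ∃ F : C(X × I, E), (∀ p, π (F p) = H p) ∧ (∀ x, F (x, 0) = f x) ∧
      ∀ x, (∀ t, H (x, t) = H (x, 0)) → ∀ t, F (x, t) = f x := by
  obtain ⟨N, hN⟩ := h.exists_near_of_dist_le H
  let c (i : ℕ) : I := Set.projIcc 0 1 zero_le_one ((i : ℝ) / (N + 1))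
  have hdist (i : ℕ) (t : I) : dist (t ⊓ c i) (t ⊓ c (i + 1)) ≤ 1 / (N + 1 : ℝ) := by
    rw [inf_comm, inf_comm t, Subtype.dist_eq, Real.dist_eq]
    refine (abs_inf_sub_inf_le_abs (c i : ℝ) (c (i + 1) : ℝ) (t : ℝ)).trans
      ((Set.abs_projIcc_sub_projIcc _).trans_eq ?_)
    rw [← sub_div, abs_div, Nat.cast_add_one, sub_add_cancel_left, abs_neg, abs_one,
      abs_of_pos (by positivity)]
  have key (i : ℕ) : ∃ F : C(X × I, E), (∀ x t, π (F (x, t)) = H (x, t ⊓ c i)) ∧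
      (∀ x, F (x, 0) = f x) ∧ ∀ x, (∀ t, H (x, t) = H (x, 0)) → ∀ t, F (x, t) = f x := by
    induction i with
    | zero =>
      refine ⟨f.comp ContinuousMap.fst, fun x t ↦ ?_, fun x ↦ rfl, fun x _ t ↦ rfl⟩
      have : t ⊓ c 0 = 0 := by simp [c]
      simp [this, hf]
    | succ i ih =>
      obtain ⟨F, hF, hF0, hFc⟩ := ih
      refine ⟨⟨fun p ↦ h.transport (F p) (H (p.1, p.2 ⊓ c (i + 1))), ?_⟩, fun x t ↦ ?_,
        fun x ↦ ?_, fun x hx t ↦ ?_⟩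
      · refine continuous_iff_continuousAt.2 fun p ↦ ?_
        refine ContinuousAt.comp (f := fun p : X × I ↦ (F p, H (p.1, p.2 ⊓ c (i + 1))))
          (h.continuousAt_transport ?_) (by fun_prop)
        rw [hF]
        exact hN _ _ _ (hdist i p.2)
      · exact h.proj_transport _ _
      · have : H (x, 0 ⊓ c (i + 1)) = π (F (x, 0)) := by simp [hF0, hf, c]
        simp only [ContinuousMap.coe_mk, this, h.transport_self, hF0]
      · have : H (x, t ⊓ c (i + 1)) = π (F (x, t)) := by rw [hFc x hx, hf, hx]
        simp only [ContinuousMap.coe_mk, this, h.transport_self, hFc x hx]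
  obtain ⟨F, hF, hF0, hFc⟩ := key (N + 1)
  refine ⟨F, fun p ↦ ?_, hF0, hFc⟩
  have : c (N + 1) = 1 := by
    simp only [c, Nat.cast_add, Nat.cast_one]
    rw [div_self (by positivity)]
    simp
  rw [hF, this, inf_of_le_left unitInterval.le_one']

theorem eq_of_circleExp_eq {X : Type*} [TopologicalSpace X] [PreconnectedSpace X]
    {u v : X → ℝ} (hu : Continuous u) (hv : Continuous v)
    (h : ∀ x, Circle.exp (u x) = Circle.exp (v x)) {x₀ : X} (h₀ : u x₀ = v x₀) : u = v :=
  Circle.isCoveringMap_exp.eq_of_comp_eq hu hv (funext h) x₀ h₀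

/-- `p` has degree `k`: it lifts to a square that is constant on three sides and winds `k` times
around the fibre along the fourth. -/
def HasDegree (π : E → B) {e₀ : E} (p : Ω^ (Fin 2) B (π e₀)) (k : ℤ) : Prop :=
  ∃ (F : C(I × I, E)) (θ : C(I, ℝ)), (∀ x s, π (F (x, s)) = p ![x, s]) ∧
    (∀ x, F (x, 0) = e₀) ∧ (∀ s, F (0, s) = e₀) ∧ (∀ s, F (1, s) = e₀) ∧
    (∀ x, F (x, 1) = Circle.exp (θ x) • e₀) ∧ θ 0 = 0 ∧ θ 1 = k * (2 * Real.pi)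

theorem continuous_mk_fin_two : Continuous fun q : I × I ↦ ![q.1, q.2] := by
  refine continuous_pi fun i ↦ ?_
  fin_cases i
  · exact continuous_fst
  · exact continuous_snd

section Degree

variable {e₀ : E} {p q : Ω^ (Fin 2) B (π e₀)}

theorem exists_hasDegree [ContinuousSMul Circle E] (h : IsCircleBundle π ψ)
    (p : Ω^ (Fin 2) B (π e₀)) : ∃ k, HasDegree π p k := by
  obtain ⟨F, hF, hF0, hFc⟩ := h.exists_homotopy_lift
    (⟨fun y ↦ p ![y.1, y.2], p.1.continuous.comp continuous_mk_fin_two⟩ : C(I × I, B))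
    (ContinuousMap.const I e₀) fun x ↦ (GenLoop.boundary p _ ⟨1, by simp⟩).symm
  have hp0 (s : I) : p ![0, s] = π e₀ := GenLoop.boundary p _ ⟨0, by simp⟩
  have hp1 (s : I) : p ![1, s] = π e₀ := GenLoop.boundary p _ ⟨0, by simp⟩
  have hs0 (s : I) : F (0, s) = e₀ := hFc 0 (fun t ↦ by simp [hp0]) s
  have hs1 (s : I) : F (1, s) = e₀ := hFc 1 (fun t ↦ by simp [hp1]) s
  have hx1 (x : I) : π e₀ = π (F (x, 1)) := by
    rw [hF]
    exact (GenLoop.boundary p _ ⟨1, by simp⟩).symm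
  let u : C(I, Circle) := ⟨fun x ↦ phase (ψ e₀ (F (x, 1))), continuous_iff_continuousAt.2 fun x ↦
    ContinuousAt.comp (f := fun x ↦ ψ e₀ (F (x, 1)))
      (continuousAt_phase (h.comparison_ne_zero (hx1 x)))
      (h.continuous_comparison.comp (by fun_prop :
        Continuous fun x ↦ (e₀, F (x, 1)))).continuousAt⟩
  have hself : phase (ψ e₀ e₀) = 1 := by simpa using h.phase_smul 1 e₀
  obtain ⟨θ, hθ, hθ0⟩ := Circle.isCoveringMap_exp.exists_path_lifts u 0 (by simp [u, hs0, hself])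
  have hθ1 : Circle.exp (θ 1) = 1 := (congrFun hθ 1).trans (by simp [u, hs1, hself])
  obtain ⟨k, hk⟩ := Circle.exp_eq_one.1 hθ1
  refine ⟨k, F, θ, fun x s ↦ hF _, hF0, hs0, hs1, fun x ↦ ?_, hθ0, hk⟩
  rw [show Circle.exp (θ x) = u x from congrFun hθ x]
  exact (h.phase_smul_self (hx1 x)).symm

theorem HasDegree.congr [ContinuousSMul Circle E] (h : IsCircleBundle π ψ) {k : ℤ}
    (hp : HasDegree π p k) (hpq : GenLoop.Homotopic p q) : HasDegree π q k := by
  obtain ⟨F, θ, hF, hF0, hs0, hs1, hx1, hθ0, hθ1⟩ := hp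
  obtain ⟨H⟩ := hpq
  obtain ⟨G, hG, hG0, hGc⟩ := h.exists_homotopy_lift
    (⟨fun y ↦ H (y.2, ![y.1.1, y.1.2]),
      H.continuous.comp (continuous_snd.prodMk (continuous_mk_fin_two.comp continuous_fst))⟩ :
        C((I × I) × I, B)) F fun y ↦ by
      simp only [ContinuousMap.coe_mk, H.apply_zero]
      exact hF _ _
  have hc (x s : I) (hxs : ![x, s] ∈ Cube.boundary (Fin 2)) : G ((x, s), 1) = F (x, s) :=
    hGc (x, s) (fun t ↦ by simp only [ContinuousMap.coe_mk, H.eq_fst _ hxs]) 1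
  refine ⟨⟨fun y ↦ G (y, 1), by fun_prop⟩, θ, fun x s ↦ ?_, fun x ↦ ?_, fun s ↦ ?_, fun s ↦ ?_,
    fun x ↦ ?_, hθ0, hθ1⟩
  · exact (hG _).trans (H.apply_one _)
  · exact (hc _ _ ⟨1, by simp⟩).trans (hF0 x)
  · exact (hc _ _ ⟨0, by simp⟩).trans (hs0 s)
  · exact (hc _ _ ⟨0, by simp⟩).trans (hs1 s)
  · exact (hc _ _ ⟨1, by simp⟩).trans (hx1 x)

theorem HasDegree.unique (h : IsCircleBundle π ψ) {k k' : ℤ}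
    (hk : HasDegree π p k) (hk' : HasDegree π p k') : k = k' := by
  obtain ⟨F, θ, hF, hF0, hs0, hs1, hx1, hθ0, hθ1⟩ := hk
  obtain ⟨F', θ', hF', hF0', hs0', hs1', hx1', hθ0', hθ1'⟩ := hk'
  have hself : phase (ψ e₀ e₀) = 1 := by simpa using h.phase_smul 1 e₀
  let c : C(I × I, Circle) := ⟨fun y ↦ phase (ψ (F y) (F' y)), continuous_iff_continuousAt.2
    fun y ↦ ContinuousAt.comp (f := fun y ↦ ψ (F y) (F' y))
      (continuousAt_phase (h.comparison_ne_zero ((hF _ _).trans (hF' _ _).symm)))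
      (h.continuous_comparison.comp (by fun_prop :
        Continuous fun y ↦ (F y, F' y))).continuousAt⟩
  have hc0 (x : I) : c (x, 0) = 1 := by simp [c, hF0, hF0', hself]
  have hcs0 (s : I) : c (0, s) = 1 := by simp [c, hs0, hs0', hself]
  have hcs1 (s : I) : c (1, s) = 1 := by simp [c, hs1, hs1', hself]
  have hc1 (x : I) : c (x, 1) = Circle.exp (θ' x - θ x) := by
    have : Circle.exp (θ' x) • e₀ = Circle.exp (θ' x - θ x) • Circle.exp (θ x) • e₀ := by
      rw [smul_smul, ← Circle.exp_add, sub_add_cancel]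
    simp only [c, ContinuousMap.coe_mk, hx1, hx1', this, h.phase_smul]
  have hH0 (s : I) : c (0, s) = Circle.exp (ContinuousMap.const I (0 : ℝ) s) := by simp [hcs0]
  let u := Circle.isCoveringMap_exp.liftHomotopy c (ContinuousMap.const I 0) hH0
  have hu (y : I × I) : Circle.exp (u y) = c y :=
    congrFun (Circle.isCoveringMap_exp.liftHomotopy_lifts c _ hH0) y
  have hleft (s : I) : u (0, s) = 0 := Circle.isCoveringMap_exp.liftHomotopy_zero c _ hH0 s
  have hbot (x : I) : u (x, 0) = 0 := congrFun (eq_of_circleExp_eq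
    (u := fun x ↦ u (x, 0)) (v := fun _ ↦ 0) (by fun_prop) continuous_const
    (fun x ↦ by simp [hu, hc0]) (hleft 0)) x
  have hright (s : I) : u (1, s) = 0 := congrFun (eq_of_circleExp_eq
    (u := fun s ↦ u (1, s)) (v := fun _ ↦ 0) (by fun_prop) continuous_const
    (fun x ↦ by simp [hu, hcs1]) (hbot 1)) s
  have htop : u (1, 1) = θ' 1 - θ 1 := congrFun (eq_of_circleExp_eq
    (u := fun x ↦ u (x, 1)) (v := fun x ↦ θ' x - θ x) (by fun_prop) (by fun_prop)
    (fun x ↦ by simp only [hu, hc1]) (x₀ := 0) (by simp [hleft, hθ0, hθ0'])) 1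
  rw [hright, hθ1, hθ1', ← sub_mul, eq_comm, mul_eq_zero_iff_right Real.two_pi_pos.ne',
    sub_eq_zero] at htop
  exact_mod_cast htop.symm

theorem HasDegree.transAt {k k' : ℤ} (hk : HasDegree π p k) (hk' : HasDegree π q k') :
    HasDegree π (GenLoop.transAt 0 p q) (k + k') := by
  obtain ⟨F, θ, hF, hF0, hs0, hs1, hx1, hθ0, hθ1⟩ := hk
  obtain ⟨F', θ', hF', hF0', hs0', hs1', hx1', hθ0', hθ1'⟩ := hk'
  have e1 : Set.projIcc (0 : ℝ) 1 zero_le_one 1 = 1 := Set.projIcc_right _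
  have e0 : Set.projIcc (0 : ℝ) 1 zero_le_one 0 = 0 := Set.projIcc_left _
  refine ⟨⟨fun y ↦ if (y.1 : ℝ) ≤ 1 / 2 then F (Set.projIcc 0 1 zero_le_one (2 * y.1), y.2)
      else F' (Set.projIcc 0 1 zero_le_one (2 * y.1 - 1), y.2), ?_⟩,
    ⟨fun x ↦ if (x : ℝ) ≤ 1 / 2 then θ (Set.projIcc 0 1 zero_le_one (2 * x))
      else k * (2 * Real.pi) + θ' (Set.projIcc 0 1 zero_le_one (2 * x - 1)), ?_⟩,
    fun x s ↦ ?_, fun x ↦ ?_, fun s ↦ ?_, fun s ↦ ?_, fun x ↦ ?_, ?_, ?_⟩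
  · refine Continuous.if_le (by fun_prop) (by fun_prop) (by fun_prop) (by fun_prop) ?_
    intro y hy
    rw [hy]
    norm_num [e1, e0, hs0', hs1]
  · refine Continuous.if_le (by fun_prop) (by fun_prop) (by fun_prop) (by fun_prop) ?_
    intro y hy
    rw [hy]
    norm_num [e1, e0, hθ0', hθ1]
  · have hupd (x' : I) : Function.update ![x, s] 0 x' = ![x', s] := by
      ext i
      fin_cases i <;> simp
    simp only [GenLoop.transAt, GenLoop.coe_copy, ContinuousMap.coe_mk, hupd,
      Matrix.cons_val_zero]
    split_ifs
    · exact hF _ _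
    · exact hF' _ _
  · simp [hF0, hF0']
  · simp [hs0]
  · norm_num [e1, hs1']
  · simp only [ContinuousMap.coe_mk]
    split_ifs
    · exact hx1 _
    · rw [hx1', Circle.exp_add, Circle.exp_eq_one.2 ⟨k, rfl⟩, one_mul]
  · simp [hθ0]
  · norm_num [hθ1', e1]
    ring

/-- Every integer is a degree if squares in the total space contract. -/
theorem exists_genLoop_hasDegree [ContinuousSMul Circle E] (h : IsCircleBundle π ψ)
    (hE : ∀ f : C(Fin 2 → I, E), f.HomotopicRel (ContinuousMap.const _ e₀) {x | f x = e₀})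
    (k : ℤ) : ∃ p : Ω^ (Fin 2) B (π e₀), HasDegree π p k := by
  let θ : C(I, ℝ) := ⟨fun x ↦ x * (k * (2 * Real.pi)), by fun_prop⟩
  have hθ1 : Circle.exp (θ 1) = 1 := by simp [θ]
  let f : C(Fin 2 → I, E) := ⟨fun y ↦ Circle.exp (θ (y 0)) • e₀, by fun_prop⟩
  obtain ⟨H⟩ := (hE f).symm
  have H0 (y : Fin 2 → I) : H (0, y) = e₀ := H.apply_zero y
  have H1 (y : Fin 2 → I) : H (1, y) = Circle.exp (θ (y 0)) • e₀ := H.apply_one y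
  have Hc (t : I) (y : Fin 2 → I) (hy : f y = e₀) : H (t, y) = e₀ := H.eq_fst t hy
  have hl (t : I) (y : Fin 2 → I) (hy : y 0 = 0) : H (t, y) = e₀ :=
    Hc t y (by simp [f, hy, θ])
  have hr (t : I) (y : Fin 2 → I) (hy : y 0 = 1) : H (t, y) = e₀ :=
    Hc t y (by simp [f, hy, hθ1])
  refine ⟨⟨⟨fun y ↦ π (H (y 1, y)), ?_⟩, ?_⟩, ⟨fun y ↦ H (y.2, ![y.1, y.2]), ?_⟩, θ,
    fun x s ↦ rfl, fun x ↦ H0 _, fun s ↦ hl _ _ rfl, fun s ↦ hr _ _ rfl, fun x ↦ H1 _, ?_, ?_⟩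
  · exact h.isOpenQuotientMap.continuous.comp (H.continuous.comp (by fun_prop))
  · rintro y ⟨i, hi⟩
    change π (H (y 1, y)) = π e₀
    fin_cases i
    · rcases hi with hi | hi
      · rw [hl _ _ hi]
      · rw [hr _ _ hi]
    · rcases hi with hi | hi
      · rw [show y 1 = 0 from hi, H0]
      · rw [show y 1 = 1 from hi, H1, h.proj_smul]
  · exact H.continuous.comp (continuous_snd.prodMk continuous_mk_fin_two)
  · simp [θ]
  · simp [θ]

/-- A generalized loop of degree zero is null-homotopic if squares in the total space contract. -/
theorem HasDegree.homotopic_const [ContinuousSMul Circle E] (h : IsCircleBundle π ψ)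
    (hE : ∀ f : C(Fin 2 → I, E), f.HomotopicRel (ContinuousMap.const _ e₀) {x | f x = e₀})
    (hp : HasDegree π p 0) : GenLoop.Homotopic p GenLoop.const := by
  obtain ⟨F, θ, hF, hF0, hs0, hs1, hx1, hθ0, hθ1⟩ := hp
  let f : C(Fin 2 → I, E) :=
    ⟨fun y ↦ Circle.exp (-((y 1 : ℝ) * θ (y 0))) • F (y 0, y 1), by fun_prop⟩
  have hf (y : Fin 2 → I) : π (f y) = p y := by
    have hy : ![y 0, y 1] = y := by
      ext i
      fin_cases i <;> rfl
    exact (h.proj_smul _ _).trans ((hF _ _).trans (by rw [hy]))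
  have hfb (y) (hy : y ∈ Cube.boundary (Fin 2)) : f y = e₀ := by
    obtain ⟨i, hi⟩ := hy
    fin_cases i
    · rcases hi with hi | hi <;> simp only [Fin.zero_eta] at hi
      · simp [f, hi, hθ0, hs0]
      · simp [f, hi, hθ1, hs1]
    · rcases hi with hi | hi <;> simp only [Fin.mk_one] at hi
      · simp [f, hi, hF0]
      · simp [f, hi, hx1]
  obtain ⟨H⟩ := hE f
  refine ⟨⟨⟨⟨fun y ↦ π (H y), h.isOpenQuotientMap.continuous.comp H.continuous⟩,
    fun y ↦ ?_, fun y ↦ ?_⟩, fun t y hy ↦ ?_⟩⟩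
  · exact (congrArg π (H.apply_zero y)).trans (hf y)
  · exact congrArg π (H.apply_one y)
  · exact (congrArg π (H.eq_fst t (hfb y hy))).trans (hf y)

end Degree

/-- The second homotopy group of the base of a circle bundle is infinite cyclic if squares in the
total space contract. -/
theorem nonempty_homotopyGroup_mulEquiv [ContinuousSMul Circle E] (h : IsCircleBundle π ψ)
    (e₀ : E)
    (hE : ∀ f : C(Fin 2 → I, E), f.HomotopicRel (ContinuousMap.const _ e₀) {x | f x = e₀}) :
    Nonempty (HomotopyGroup (Fin 2) B (π e₀) ≃* Multiplicative ℤ) := by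
  choose d hd using fun p : Ω^ (Fin 2) B (π e₀) ↦ h.exists_hasDegree p
  let deg : HomotopyGroup (Fin 2) B (π e₀) → Multiplicative ℤ :=
    Quotient.lift (fun p ↦ Multiplicative.ofAdd (d p)) fun p q hpq ↦
      congrArg _ (((hd p).congr h hpq).unique h (hd q))
  let φ : HomotopyGroup (Fin 2) B (π e₀) →* Multiplicative ℤ := MonoidHom.mk' deg fun a b ↦ by
    induction a using Quotient.inductionOn with | _ p
    induction b using Quotient.inductionOn with | _ q
    have hm := HomotopyGroup.mul_spec (i := (0 : Fin 2)) (p := p) (q := q)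
    refine (congrArg deg hm).trans ?_
    change Multiplicative.ofAdd (d _) = Multiplicative.ofAdd (d p) * Multiplicative.ofAdd (d q)
    rw [(hd _).unique h ((hd q).transAt (hd p)), ← ofAdd_add, add_comm]
  refine ⟨MulEquiv.ofBijective φ ⟨(injective_iff_map_eq_one φ).2 fun a ha ↦ ?_, fun k ↦ ?_⟩⟩
  · induction a using Quotient.inductionOn with | _ p
    have h0 : d p = 0 := ha
    exact Quotient.sound ((h0 ▸ hd p : HasDegree π p 0).homotopic_const h hE)
  · obtain ⟨p, hp⟩ := h.exists_genLoop_hasDegree hE k.toAdd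
    exact ⟨Quotient.mk _ p, congrArg Multiplicative.ofAdd ((hd p).unique h hp)⟩

end IsCircleBundle

section Monomial

open ComplexConjugate

/-- A polynomial substitute for `z ↦ z ^ k`: for negative `k` it is `conj z ^ (-k)`. -/
def signedPow (z : ℂ) : ℤ → ℂ
  | .ofNat k => z ^ k
  | .negSucc k => conj z ^ (k + 1)

theorem continuous_signedPow (k : ℤ) : Continuous fun z ↦ signedPow z k := by
  cases k <;> simp only [signedPow] <;> fun_prop

theorem signedPow_circle_mul (x : Circle) (z : ℂ) (k : ℤ) :
    signedPow (x * z) k = (x ^ k : Circle) * signedPow z k := by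
  cases k with
  | ofNat k => simp [signedPow, mul_pow]
  | negSucc k =>
    simp [signedPow, mul_pow, zpow_negSucc, ← Circle.coe_inv_eq_conj]

theorem signedPow_ofReal (r : ℝ) (k : ℤ) : signedPow r k = (r ^ k.natAbs : ℝ) := by
  cases k <;> simp [signedPow]

end Monomial

section Total

open ComplexConjugate Metric

@[simp] theorem cq_re (z : ℂ) : (cq z).re = z.re := rfl

@[simp] theorem cq_imI (z : ℂ) : (cq z).imI = z.im := rfl

@[simp] theorem cq_imJ (z : ℂ) : (cq z).imJ = 0 := rfl

@[simp] theorem cq_imK (z : ℂ) : (cq z).imK = 0 := rfl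

theorem cq_mul (z w : ℂ) : cq (z * w) = cq z * cq w := by
  ext <;> simp [Quaternion.re_mul, Quaternion.imI_mul, Quaternion.imJ_mul, Quaternion.imK_mul]

theorem cq_one : cq 1 = 1 := by ext <;> simp

theorem norm_cq (z : ℂ) : ‖cq z‖ = ‖z‖ := by
  rw [← sq_eq_sq₀ (norm_nonneg _) (norm_nonneg _), Complex.sq_norm, sq,
    ← Quaternion.normSq_eq_norm_mul_self, Quaternion.normSq_def', Complex.normSq_apply]
  simp [sq]

theorem Quaternion.continuous_of_components {X : Type*} [TopologicalSpace X] {f : X → ℍ[ℝ]}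
    (hr : Continuous fun x ↦ (f x).re) (hi : Continuous fun x ↦ (f x).imI)
    (hj : Continuous fun x ↦ (f x).imJ) (hk : Continuous fun x ↦ (f x).imK) : Continuous f := by
  rw [← Quaternion.linearIsometryEquivTuple.toHomeomorph.comp_continuous_iff]
  refine (PiLp.continuous_toLp 2 _).comp (continuous_pi fun i ↦ ?_)
  fin_cases i
  exacts [hr, hi, hj, hk]

theorem continuous_cq : Continuous cq :=
  Quaternion.continuous_of_components Complex.continuous_re Complex.continuous_im continuous_const
    continuous_const

/-- The circle action on the total space. -/
abbrev totalSpaceAction (l m n : ℕ) : MulAction Circle TotalSpace where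
  smul x a := ⟨circleAct l m n x a.1, by
    have hx (k : ℕ) : ‖(x : ℂ) ^ k‖ = 1 := by rw [norm_pow, Circle.norm_coe, one_pow]
    simp [circleAct, norm_cq, hx, a.2.1, a.2.2]⟩
  one_smul a := Subtype.ext (by change circleAct l m n 1 a.1 = a.1; simp [circleAct, cq_one])
  mul_smul x y a := Subtype.ext <| by
    change circleAct l m n (x * y) a.1 = circleAct l m n x (circleAct l m n y a.1)
    simp only [circleAct, Circle.coe_mul, mul_pow, mul_assoc, ← cq_mul, mul_comm]
    simp [mul_left_comm]

theorem continuousSMul_totalSpaceAction (l m n : ℕ) :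
    letI := totalSpaceAction l m n
    ContinuousSMul Circle TotalSpace := by
  let := totalSpaceAction l m n
  refine ⟨Continuous.subtype_mk ?_ _⟩
  have := continuous_cq
  unfold circleAct
  fun_prop

/-- The `ℂ`-valued pairing of quaternions: the complex part of `star p * q`. -/
def quaternionPairing (p q : ℍ[ℝ]) : ℂ := ⟨(star p * q).re, (star p * q).imI⟩

theorem continuous_quaternionPairing :
    Continuous fun y : ℍ[ℝ] × ℍ[ℝ] ↦ quaternionPairing y.1 y.2 := by
  have h1 : Continuous fun y : ℍ[ℝ] × ℍ[ℝ] ↦ (star y.1 * y.2).re :=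
    Quaternion.continuous_re.comp (by fun_prop)
  have h2 : Continuous fun y : ℍ[ℝ] × ℍ[ℝ] ↦ (star y.1 * y.2).imI :=
    Quaternion.continuous_imI.comp (by fun_prop)
  exact Complex.equivRealProdCLM.symm.continuous.comp (h1.prodMk h2)

theorem quaternionPairing_mul_cq (p q : ℍ[ℝ]) (z : ℂ) :
    quaternionPairing p (q * cq z) = z * quaternionPairing p q := by
  apply Complex.ext <;>
  simp [quaternionPairing, Quaternion.re_mul, Quaternion.imI_mul, Quaternion.imJ_mul,
    Quaternion.imK_mul] <;> ring

theorem quaternionPairing_mul_cq_left (p q : ℍ[ℝ]) (z : ℂ) :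
    quaternionPairing (p * cq z) q = conj z * quaternionPairing p q := by
  apply Complex.ext <;>
  simp [quaternionPairing, Quaternion.re_mul, Quaternion.imI_mul, Quaternion.imJ_mul,
    Quaternion.imK_mul] <;> ring

theorem quaternionPairing_self {p : ℍ[ℝ]} (hp : ‖p‖ = 1) : quaternionPairing p p = 1 := by
  have h := Quaternion.star_mul_self p
  rw [Quaternion.normSq_eq_norm_mul_self, hp] at h
  rw [quaternionPairing, h]
  apply Complex.ext <;> simp

/-- Comparison function for the circle action with weights `l, m, n` on the total space, where
`α l + β m = 1 = α' l + β' n`. -/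
def totalSpaceComparison (α β α' β' : ℤ) (e e' : TotalSpace) : ℂ :=
  signedPow (quaternionPairing e.1.1 e'.1.1) α * signedPow (conj e.1.2.1 * e'.1.2.1) β +
    signedPow (quaternionPairing e.1.1 e'.1.1) α' * signedPow (conj e.1.2.2 * e'.1.2.2) β'

theorem signedPow_mul_signedPow {j k : ℕ} {α β : ℤ} (h : α * j + β * k = 1) (x : Circle)
    (a b : ℂ) : signedPow ((x ^ j : Circle) * a) α * signedPow ((x ^ k : Circle) * b) β =
      x * (signedPow a α * signedPow b β) := by
  have : (x ^ j : Circle) ^ α * (x ^ k : Circle) ^ β = x := by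
    rw [← zpow_natCast, ← zpow_natCast, ← zpow_mul, ← zpow_mul, ← zpow_add, mul_comm, mul_comm _ β,
      h, zpow_one]
  rw [signedPow_circle_mul, signedPow_circle_mul, mul_mul_mul_comm, ← Circle.coe_mul, this]

theorem isCircleBundle_NSpace {l m n : ℕ} {α β α' β' : ℤ} (h : α * l + β * m = 1)
    (h' : α' * l + β' * n = 1) :
    letI := totalSpaceAction l m n
    IsCircleBundle (Quot.mk (NRel l m n)) (totalSpaceComparison α β α' β') := by
  let := totalSpaceAction l m n
  have := continuousSMul_totalSpaceAction l m n
  have hrel (a b : TotalSpace) : NRel l m n a b ↔ ∃ x : Circle, x • a = b :=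
    exists_congr fun x ↦ by rw [Subtype.ext_iff]; rfl
  have heq (a b : TotalSpace) : Quot.mk (NRel l m n) a = Quot.mk (NRel l m n) b ↔
      ∃ x : Circle, x • a = b := by
    rw [← hrel, Equivalence.quot_mk_eq_iff]
    refine ⟨fun a ↦ (hrel _ _).2 ⟨1, one_smul _ _⟩, fun {a b} hab ↦ ?_, fun {a b c} hab hbc ↦ ?_⟩
    · obtain ⟨x, rfl⟩ := (hrel _ _).1 hab
      exact (hrel _ _).2 ⟨x⁻¹, inv_smul_smul x a⟩
    · obtain ⟨x, rfl⟩ := (hrel _ _).1 hab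
      obtain ⟨y, rfl⟩ := (hrel _ _).1 hbc
      exact (hrel _ _).2 ⟨y * x, mul_smul y x a⟩
  refine ⟨⟨Quot.mk_surjective, continuous_quot_mk, fun U hU ↦ ?_⟩, heq, ?_, fun x e e' ↦ ?_,
    fun x e e' ↦ ?_, fun e ↦ ?_⟩
  · rw [← isQuotientMap_quot_mk.isOpen_preimage]
    have : Quot.mk (NRel l m n) ⁻¹' (Quot.mk (NRel l m n) '' U) =
        ⋃ x : Circle, (fun a ↦ x • a) ⁻¹' U := by
      ext b
      simp only [Set.mem_preimage, Set.mem_image, Set.mem_iUnion]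
      constructor
      · rintro ⟨a, ha, hab⟩
        obtain ⟨x, hx⟩ := (heq _ _).1 hab.symm
        exact ⟨x, hx ▸ ha⟩
      · rintro ⟨x, hx⟩
        exact ⟨x • b, hx, ((heq _ _).2 ⟨x, rfl⟩).symm⟩
    rw [this]
    exact isOpen_iUnion fun x ↦ hU.preimage (continuous_const_smul x)
  · have hq : Continuous fun y : TotalSpace × TotalSpace ↦ quaternionPairing y.1.1.1 y.2.1.1 :=
      continuous_quaternionPairing.comp (by fun_prop :
        Continuous fun y : TotalSpace × TotalSpace ↦ (y.1.1.1, y.2.1.1))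
    exact (((continuous_signedPow α).comp hq).mul ((continuous_signedPow β).comp
      (by fun_prop))).add (((continuous_signedPow α').comp hq).mul
        ((continuous_signedPow β').comp (by fun_prop)))
  · change totalSpaceComparison _ _ _ _ e ⟨circleAct l m n x e'.1, _⟩ = _
    simp only [totalSpaceComparison, circleAct, quaternionPairing_mul_cq, mul_add,
      mul_left_comm (conj _), ← Circle.coe_pow, signedPow_mul_signedPow h,
      signedPow_mul_signedPow h']
  · change totalSpaceComparison _ _ _ _ ⟨circleAct l m n x e.1, _⟩ e' = _
    simp only [totalSpaceComparison, circleAct, quaternionPairing_mul_cq_left, mul_add,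
      map_mul, ← Circle.coe_pow, ← Circle.coe_inv_eq_conj, ← inv_pow, mul_assoc,
      signedPow_mul_signedPow h, signedPow_mul_signedPow h']
  · have hone (k : ℤ) : signedPow 1 k = 1 := by simpa using signedPow_ofReal 1 k
    refine ⟨Complex.normSq e.1.2.1 ^ β.natAbs + Complex.normSq e.1.2.2 ^ β'.natAbs, ?_, ?_⟩
    · have h1 := e.2.2
      have hz := Complex.normSq_nonneg e.1.2.1
      have hw := Complex.normSq_nonneg e.1.2.2
      rcases hz.eq_or_lt with h0 | h0
      · have : 0 < Complex.normSq e.1.2.2 := by linarith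
        positivity
      · positivity
    · simp only [totalSpaceComparison, quaternionPairing_self e.2.1, hone, one_mul,
        ← Complex.normSq_eq_conj_mul_self, signedPow_ofReal, Complex.ofReal_add]

/-- The isometry `ℂ² → ℍ` given by the real coordinates. -/
def pairToQuaternion (y : ℂ × ℂ) : ℍ[ℝ] := ⟨y.1.re, y.1.im, y.2.re, y.2.im⟩

theorem continuous_pairToQuaternion : Continuous pairToQuaternion :=
  Quaternion.continuous_of_components (Complex.continuous_re.comp continuous_fst)
    (Complex.continuous_im.comp continuous_fst) (Complex.continuous_re.comp continuous_snd)
    (Complex.continuous_im.comp continuous_snd)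

theorem norm_pairToQuaternion_eq_one {y : ℂ × ℂ} :
    ‖pairToQuaternion y‖ = 1 ↔ Complex.normSq y.1 + Complex.normSq y.2 = 1 := by
  rw [← pow_eq_one_iff_of_nonneg (norm_nonneg _) two_ne_zero, sq,
    ← Quaternion.normSq_eq_norm_mul_self, Quaternion.normSq_def', Complex.normSq_apply,
    Complex.normSq_apply]
  simp only [pairToQuaternion]
  ring_nf

/-- The total space is a product of two unit spheres of quaternions. -/
def totalSpaceHomeomorph : TotalSpace ≃ₜ sphere (0 : ℍ[ℝ]) 1 × sphere (0 : ℍ[ℝ]) 1 where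
  toFun a := (⟨a.1.1, by simpa using a.2.1⟩,
    ⟨pairToQuaternion a.1.2, by simpa using norm_pairToQuaternion_eq_one.2 a.2.2⟩)
  invFun b := ⟨(b.1, (⟨b.2.1.re, b.2.1.imI⟩, ⟨b.2.1.imJ, b.2.1.imK⟩)),
    by simp, norm_pairToQuaternion_eq_one.1 (mem_sphere_zero_iff_norm.1 b.2.2)⟩
  left_inv a := rfl
  right_inv b := rfl
  continuous_toFun := by
    have := continuous_pairToQuaternion
    fun_prop
  continuous_invFun := by
    have h : Continuous fun y : ℝ × ℝ ↦ (⟨y.1, y.2⟩ : ℂ) :=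
      Complex.equivRealProdCLM.symm.continuous
    have hs : Continuous fun b : sphere (0 : ℍ[ℝ]) 1 × sphere (0 : ℍ[ℝ]) 1 ↦ (b.2 : ℍ[ℝ]) := by
      fun_prop
    exact Continuous.subtype_mk ((continuous_subtype_val.comp continuous_fst).prodMk
      ((h.comp ((Quaternion.continuous_re.comp hs).prodMk
        (Quaternion.continuous_imI.comp hs))).prodMk
      (h.comp ((Quaternion.continuous_imJ.comp hs).prodMk
        (Quaternion.continuous_imK.comp hs))))) _

theorem TotalSpace.homotopicRel_const (f : C(Fin 2 → I, TotalSpace)) (e : TotalSpace) :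
    f.HomotopicRel (ContinuousMap.const _ e) {x | f x = e} := by
  let Φ : C(TotalSpace, sphere (0 : ℍ[ℝ]) 1 × sphere (0 : ℍ[ℝ]) 1) := totalSpaceHomeomorph
  have hk : 2 + 1 < Module.finrank ℝ ℍ[ℝ] := by simp [Quaternion.finrank_eq_four]
  obtain ⟨H₁⟩ := homotopicRel_const_of_lt_finrank hk (ContinuousMap.fst.comp (Φ.comp f)) (Φ e).1
  obtain ⟨H₂⟩ := homotopicRel_const_of_lt_finrank hk (ContinuousMap.snd.comp (Φ.comp f)) (Φ e).2
  refine ⟨⟨⟨⟨fun y ↦ totalSpaceHomeomorph.symm (H₁ y, H₂ y), by fun_prop⟩, fun x ↦ ?_,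
    fun x ↦ ?_⟩, fun t x hx ↦ ?_⟩⟩
  · simp [Φ]
  · simp [Φ]
  · have hx' : f x = e := hx
    have h₁ := H₁.prop' t x (by simp [hx'])
    have h₂ := H₂.prop' t x (by simp [hx'])
    change totalSpaceHomeomorph.symm (H₁ (t, x), H₂ (t, x)) = f x
    change H₁ (t, x) = (Φ (f x)).1 at h₁
    change H₂ (t, x) = (Φ (f x)).2 at h₂
    rw [h₁, h₂]
    rfl

end Total

/-- **The second homotopy group of `𝔑^l_{m,n}`.**
If `gcd(l,m) = gcd(l,n) = 1`, then for any basepoint the second homotopy group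
`π₂(𝔑^l_{m,n})` is infinite cyclic, i.e. isomorphic as a group to `ℤ`. -/
theorem NSpace_pi2_infinite_cyclic (l m n : ℕ)
    (hlm : Nat.gcd l m = 1) (hln : Nat.gcd l n = 1) (pt : NSpace l m n) :
    Nonempty (HomotopyGroup (Fin 2) (NSpace l m n) pt ≃* Multiplicative ℤ) := by
  obtain ⟨e₀, rfl⟩ := Quot.exists_rep pt
  obtain ⟨α, β, h⟩ := Nat.isCoprime_iff_coprime.2 hlm
  obtain ⟨α', β', h'⟩ := Nat.isCoprime_iff_coprime.2 hln
  let := totalSpaceAction l m n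
  have := continuousSMul_totalSpaceAction l m n
  exact (isCircleBundle_NSpace h h').nonempty_homotopyGroup_mulEquiv e₀
    fun f ↦ TotalSpace.homotopicRel_const f e₀
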